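/- (Sel-<: Replacement Lemma) If Γ is an inert typing context and Γ ⊢# x : {A : S..U} under tight typing, then Γ ⊢# S <: x.A and Γ ⊢# x.A <: U under tight subtyping. -/

import Mathlib

/- Variables and labels -/
abbrev Vr := ℕ
abbrev TrmLabel := ℕ
abbrev TypLabel := ℕ

/- Types of the DOT calculus -/
inductive Typ : Type
| top : Typ                          -- ⊤
| bot : Typ                          -- ⊥
| all : Vr → Typ → Typ → Typ         -- ∀(x:S)T
| mu  : Vr → Typ → Typ               -- μ(x:T)
| fld : TrmLabel → Typ → Typ         -- {a : T}
| dec : TypLabel → Typ → Typ → Typ   -- {A : S..T}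
| sel : Vr → TypLabel → Typ          -- x.A
| and : Typ → Typ → Typ              -- S ∧ T
deriving DecidableEq

/- Terms, values, definitions -/
mutual
inductive Trm : Type
| var : Vr → Trm
| val : Vl → Trm
| sel : Vr → TrmLabel → Trm
| app : Vr → Vr → Trm
| lett : Vr → Trm → Trm → Trm
deriving DecidableEq
inductive Vl : Type
| lam : Vr → Typ → Trm → Vl          -- λ(x:T)t
| obj : Vr → Typ → Dfs → Vl          -- ν(x:T)d
deriving DecidableEq
inductive Dfs : Type
| fld : TrmLabel → Trm → Dfs         -- {a = t}
| typ : TypLabel → Typ → Dfs         -- {A = T}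
| and : Dfs → Dfs → Dfs
deriving DecidableEq
end

/- Free variables -/
def Typ.fv : Typ → Finset Vr
| .top => ∅
| .bot => ∅
| .all x S T => S.fv ∪ (T.fv \ {x})
| .mu x T => T.fv \ {x}
| .fld _ T => T.fv
| .dec _ S T => S.fv ∪ T.fv
| .sel x _ => {x}
| .and S T => S.fv ∪ T.fv

mutual
def Trm.fv : Trm → Finset Vr
| .var x => {x}
| .val v => v.fv
| .sel x _ => {x}
| .app x y => {x, y}
| .lett x t u => t.fv ∪ (u.fv \ {x})
def Vl.fv : Vl → Finset Vr
| .lam x T t => T.fv ∪ (t.fv \ {x})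
| .obj x T d => (T.fv ∪ d.fv) \ {x}
def Dfs.fv : Dfs → Finset Vr
| .fld _ t => t.fv
| .typ _ T => T.fv
| .and d₁ d₂ => d₁.fv ∪ d₂.fv
end

/- Substitution of variable y for variable x (capture-avoiding; only
   variable-for-variable substitution is needed in DOT) -/
def Typ.subst (x y : Vr) : Typ → Typ
| .top => .top
| .bot => .bot
| .all z S T => .all z (S.subst x y) (if z = x then T else T.subst x y)
| .mu z T => .mu z (if z = x then T else T.subst x y)
| .fld a T => .fld a (T.subst x y)
| .dec A S T => .dec A (S.subst x y) (T.subst x y)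
| .sel z A => .sel (if z = x then y else z) A
| .and S T => .and (S.subst x y) (T.subst x y)

mutual
def Trm.subst (x y : Vr) : Trm → Trm
| .var z => .var (if z = x then y else z)
| .val v => .val (v.subst x y)
| .sel z a => .sel (if z = x then y else z) a
| .app z w => .app (if z = x then y else z) (if w = x then y else w)
| .lett z t u => .lett z (t.subst x y) (if z = x then u else u.subst x y)
def Vl.subst (x y : Vr) : Vl → Vl
| .lam z T t => .lam z (T.subst x y) (if z = x then t else t.subst x y)
| .obj z T d => .obj z (if z = x then T else T.subst x y) (if z = x then d else d.subst x y)
def Dfs.subst (x y : Vr) : Dfs → Dfs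
| .fld a t => .fld a (t.subst x y)
| .typ A T => .typ A (T.subst x y)
| .and d₁ d₂ => .and (d₁.subst x y) (d₂.subst x y)
end

/- Typing contexts -/
abbrev Ctx := List (Vr × Typ)

def lookupCtx : Ctx → Vr → Option Typ
| [], _ => none
| (y, T) :: Γ, x => if x = y then some T else lookupCtx Γ x

/- Domain (labels) of a collection of definitions -/
def Dfs.dom : Dfs → Finset (TrmLabel ⊕ TypLabel)
| .fld a _ => {Sum.inl a}
| .typ A _ => {Sum.inr A}
| .and d₁ d₂ => d₁.dom ∪ d₂.dom

/- Record types: intersections of field declarations and tight type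
   declarations with pairwise distinct type labels (the Finset collects
   the type labels) -/
inductive RecordTyp : Typ → Finset TypLabel → Prop
| fld : ∀ (a : TrmLabel) (T : Typ), RecordTyp (.fld a T) ∅
| dec : ∀ (A : TypLabel) (T : Typ), RecordTyp (.dec A T T) {A}
| and : ∀ {T U : Typ} {L₁ L₂ : Finset TypLabel},
    RecordTyp T L₁ → RecordTyp U L₂ → Disjoint L₁ L₂ → RecordTyp (.and T U) (L₁ ∪ L₂)

/- Inert types and inert contexts -/
inductive Inert : Typ → Prop
| all : ∀ (x : Vr) (S T : Typ), Inert (.all x S T)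
| mu : ∀ {x : Vr} {T : Typ} {L : Finset TypLabel}, RecordTyp T L → Inert (.mu x T)

def InertCtx (Γ : Ctx) : Prop := ∀ x T, lookupCtx Γ x = some T → Inert T

/- General typing, definition typing and subtyping -/
mutual
inductive HasTyp : Ctx → Trm → Typ → Prop
| var : ∀ {Γ : Ctx} {x : Vr} {T : Typ},
    lookupCtx Γ x = some T → HasTyp Γ (.var x) T
| allI : ∀ {Γ : Ctx} {x : Vr} {T U : Typ} {t : Trm},
    HasTyp ((x, T) :: Γ) t U → x ∉ T.fv →
    HasTyp Γ (.val (.lam x T t)) (.all x T U)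
| allE : ∀ {Γ : Ctx} {x y z : Vr} {S T : Typ},
    HasTyp Γ (.var x) (.all z S T) → HasTyp Γ (.var y) S →
    HasTyp Γ (.app x y) (T.subst z y)
| objI : ∀ {Γ : Ctx} {x : Vr} {T : Typ} {d : Dfs},
    DefTyp ((x, T) :: Γ) d T → HasTyp Γ (.val (.obj x T d)) (.mu x T)
| fldE : ∀ {Γ : Ctx} {x : Vr} {a : TrmLabel} {T : Typ},
    HasTyp Γ (.var x) (.fld a T) → HasTyp Γ (.sel x a) T
| lett : ∀ {Γ : Ctx} {x : Vr} {t u : Trm} {T U : Typ},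
    HasTyp Γ t T → HasTyp ((x, T) :: Γ) u U → x ∉ U.fv →
    HasTyp Γ (.lett x t u) U
| recI : ∀ {Γ : Ctx} {x : Vr} {T : Typ},
    HasTyp Γ (.var x) T → HasTyp Γ (.var x) (.mu x T)
| recE : ∀ {Γ : Ctx} {x z : Vr} {T : Typ},
    HasTyp Γ (.var x) (.mu z T) → HasTyp Γ (.var x) (T.subst z x)
| andI : ∀ {Γ : Ctx} {x : Vr} {T U : Typ},
    HasTyp Γ (.var x) T → HasTyp Γ (.var x) U → HasTyp Γ (.var x) (.and T U)
| sub : ∀ {Γ : Ctx} {t : Trm} {T U : Typ},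
    HasTyp Γ t T → Subtyp Γ T U → HasTyp Γ t U

inductive DefTyp : Ctx → Dfs → Typ → Prop
| fld : ∀ {Γ : Ctx} {a : TrmLabel} {t : Trm} {U : Typ},
    HasTyp Γ t U → DefTyp Γ (.fld a t) (.fld a U)
| typ : ∀ {Γ : Ctx} (A : TypLabel) (T : Typ), DefTyp Γ (.typ A T) (.dec A T T)
| and : ∀ {Γ : Ctx} {d₁ d₂ : Dfs} {T₁ T₂ : Typ},
    DefTyp Γ d₁ T₁ → DefTyp Γ d₂ T₂ → Disjoint d₁.dom d₂.dom →
    DefTyp Γ (.and d₁ d₂) (.and T₁ T₂)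

inductive Subtyp : Ctx → Typ → Typ → Prop
| top : ∀ {Γ : Ctx} {T : Typ}, Subtyp Γ T .top
| bot : ∀ {Γ : Ctx} {T : Typ}, Subtyp Γ .bot T
| refl : ∀ {Γ : Ctx} {T : Typ}, Subtyp Γ T T
| trans : ∀ {Γ : Ctx} {S T U : Typ},
    Subtyp Γ S T → Subtyp Γ T U → Subtyp Γ S U
| and1 : ∀ {Γ : Ctx} {T U : Typ}, Subtyp Γ (.and T U) T
| and2 : ∀ {Γ : Ctx} {T U : Typ}, Subtyp Γ (.and T U) U
| andI : ∀ {Γ : Ctx} {S T U : Typ},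
    Subtyp Γ S T → Subtyp Γ S U → Subtyp Γ S (.and T U)
| fld : ∀ {Γ : Ctx} {a : TrmLabel} {T U : Typ},
    Subtyp Γ T U → Subtyp Γ (.fld a T) (.fld a U)
| typ : ∀ {Γ : Ctx} {A : TypLabel} {S₁ S₂ T₁ T₂ : Typ},
    Subtyp Γ S₂ S₁ → Subtyp Γ T₁ T₂ →
    Subtyp Γ (.dec A S₁ T₁) (.dec A S₂ T₂)
| selLo : ∀ {Γ : Ctx} {x : Vr} {A : TypLabel} {S T : Typ},
    HasTyp Γ (.var x) (.dec A S T) → Subtyp Γ S (.sel x A)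
| selHi : ∀ {Γ : Ctx} {x : Vr} {A : TypLabel} {S T : Typ},
    HasTyp Γ (.var x) (.dec A S T) → Subtyp Γ (.sel x A) T
| all : ∀ {Γ : Ctx} {x : Vr} {S₁ S₂ T₁ T₂ : Typ},
    Subtyp Γ S₂ S₁ → Subtyp ((x, S₂) :: Γ) T₁ T₂ →
    Subtyp Γ (.all x S₁ T₁) (.all x S₂ T₂)
end

/- Precise typing  Γ ⊢! t : T -/
inductive PrecTyp : Ctx → Trm → Typ → Prop
| var : ∀ {Γ : Ctx} {x : Vr} {T : Typ},
    lookupCtx Γ x = some T → PrecTyp Γ (.var x) T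
| recE : ∀ {Γ : Ctx} {x z : Vr} {T : Typ},
    PrecTyp Γ (.var x) (.mu z T) → PrecTyp Γ (.var x) (T.subst z x)
| and1 : ∀ {Γ : Ctx} {x : Vr} {T U : Typ},
    PrecTyp Γ (.var x) (.and T U) → PrecTyp Γ (.var x) T
| and2 : ∀ {Γ : Ctx} {x : Vr} {T U : Typ},
    PrecTyp Γ (.var x) (.and T U) → PrecTyp Γ (.var x) U
| allI : ∀ {Γ : Ctx} {x : Vr} {T U : Typ} {t : Trm},
    HasTyp ((x, T) :: Γ) t U → x ∉ T.fv →
    PrecTyp Γ (.val (.lam x T t)) (.all x T U)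
| objI : ∀ {Γ : Ctx} {x : Vr} {T : Typ} {d : Dfs},
    DefTyp ((x, T) :: Γ) d T → PrecTyp Γ (.val (.obj x T d)) (.mu x T)

/- Tight typing  Γ ⊢# t : T  and tight subtyping  Γ ⊢# S <: U -/
mutual
inductive TightTyp : Ctx → Trm → Typ → Prop
| var : ∀ {Γ : Ctx} {x : Vr} {T : Typ},
    lookupCtx Γ x = some T → TightTyp Γ (.var x) T
| allI : ∀ {Γ : Ctx} {x : Vr} {T U : Typ} {t : Trm},
    HasTyp ((x, T) :: Γ) t U → x ∉ T.fv →
    TightTyp Γ (.val (.lam x T t)) (.all x T U)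
| allE : ∀ {Γ : Ctx} {x y z : Vr} {S T : Typ},
    TightTyp Γ (.var x) (.all z S T) → TightTyp Γ (.var y) S →
    TightTyp Γ (.app x y) (T.subst z y)
| objI : ∀ {Γ : Ctx} {x : Vr} {T : Typ} {d : Dfs},
    DefTyp ((x, T) :: Γ) d T → TightTyp Γ (.val (.obj x T d)) (.mu x T)
| fldE : ∀ {Γ : Ctx} {x : Vr} {a : TrmLabel} {T : Typ},
    TightTyp Γ (.var x) (.fld a T) → TightTyp Γ (.sel x a) T
| lett : ∀ {Γ : Ctx} {x : Vr} {t u : Trm} {T U : Typ},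
    TightTyp Γ t T → HasTyp ((x, T) :: Γ) u U → x ∉ U.fv →
    TightTyp Γ (.lett x t u) U
| recI : ∀ {Γ : Ctx} {x : Vr} {T : Typ},
    TightTyp Γ (.var x) T → TightTyp Γ (.var x) (.mu x T)
| recE : ∀ {Γ : Ctx} {x z : Vr} {T : Typ},
    TightTyp Γ (.var x) (.mu z T) → TightTyp Γ (.var x) (T.subst z x)
| andI : ∀ {Γ : Ctx} {x : Vr} {T U : Typ},
    TightTyp Γ (.var x) T → TightTyp Γ (.var x) U → TightTyp Γ (.var x) (.and T U)
| sub : ∀ {Γ : Ctx} {t : Trm} {T U : Typ},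
    TightTyp Γ t T → TightSub Γ T U → TightTyp Γ t U

inductive TightSub : Ctx → Typ → Typ → Prop
| top : ∀ {Γ : Ctx} {T : Typ}, TightSub Γ T .top
| bot : ∀ {Γ : Ctx} {T : Typ}, TightSub Γ .bot T
| refl : ∀ {Γ : Ctx} {T : Typ}, TightSub Γ T T
| trans : ∀ {Γ : Ctx} {S T U : Typ},
    TightSub Γ S T → TightSub Γ T U → TightSub Γ S U
| and1 : ∀ {Γ : Ctx} {T U : Typ}, TightSub Γ (.and T U) T
| and2 : ∀ {Γ : Ctx} {T U : Typ}, TightSub Γ (.and T U) U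
| andI : ∀ {Γ : Ctx} {S T U : Typ},
    TightSub Γ S T → TightSub Γ S U → TightSub Γ S (.and T U)
| fld : ∀ {Γ : Ctx} {a : TrmLabel} {T U : Typ},
    TightSub Γ T U → TightSub Γ (.fld a T) (.fld a U)
| typ : ∀ {Γ : Ctx} {A : TypLabel} {S₁ S₂ T₁ T₂ : Typ},
    TightSub Γ S₂ S₁ → TightSub Γ T₁ T₂ →
    TightSub Γ (.dec A S₁ T₁) (.dec A S₂ T₂)
| selLo : ∀ {Γ : Ctx} {x : Vr} {A : TypLabel} {T : Typ},
    PrecTyp Γ (.var x) (.dec A T T) → TightSub Γ T (.sel x A)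
| selHi : ∀ {Γ : Ctx} {x : Vr} {A : TypLabel} {T : Typ},
    PrecTyp Γ (.var x) (.dec A T T) → TightSub Γ (.sel x A) T
| all : ∀ {Γ : Ctx} {x : Vr} {S₁ S₂ T₁ T₂ : Typ},
    TightSub Γ S₂ S₁ → Subtyp ((x, S₂) :: Γ) T₁ T₂ →
    TightSub Γ (.all x S₁ T₁) (.all x S₂ T₂)
end

/- Invertible typing  Γ ⊢## t : T  for variables and values -/
inductive InvTyp : Ctx → Trm → Typ → Prop
| var : ∀ {Γ : Ctx} {x : Vr} {T : Typ},
    PrecTyp Γ (.var x) T → InvTyp Γ (.var x) T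
| fld : ∀ {Γ : Ctx} {x : Vr} {a : TrmLabel} {T U : Typ},
    InvTyp Γ (.var x) (.fld a T) → TightSub Γ T U →
    InvTyp Γ (.var x) (.fld a U)
| typ : ∀ {Γ : Ctx} {x : Vr} {A : TypLabel} {T T' U U' : Typ},
    InvTyp Γ (.var x) (.dec A T U) → TightSub Γ T' T → TightSub Γ U U' →
    InvTyp Γ (.var x) (.dec A T' U')
| recI : ∀ {Γ : Ctx} {x : Vr} {T : Typ},
    InvTyp Γ (.var x) T → InvTyp Γ (.var x) (.mu x T)
| allI : ∀ {Γ : Ctx} {x z : Vr} {S S' T T' : Typ},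
    InvTyp Γ (.var x) (.all z S T) → TightSub Γ S' S →
    Subtyp ((z, S') :: Γ) T T' →
    InvTyp Γ (.var x) (.all z S' T')
| andI : ∀ {Γ : Ctx} {x : Vr} {T U : Typ},
    InvTyp Γ (.var x) T → InvTyp Γ (.var x) U → InvTyp Γ (.var x) (.and T U)
| sel : ∀ {Γ : Ctx} {x y : Vr} {A : TypLabel} {S : Typ},
    InvTyp Γ (.var x) S → PrecTyp Γ (.var y) (.dec A S S) →
    InvTyp Γ (.var x) (.sel y A)
| top : ∀ {Γ : Ctx} {x : Vr} {T : Typ},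
    InvTyp Γ (.var x) T → InvTyp Γ (.var x) .top
| val : ∀ {Γ : Ctx} {v : Vl} {T : Typ},
    PrecTyp Γ (.val v) T → InvTyp Γ (.val v) T
| allV : ∀ {Γ : Ctx} {v : Vl} {z : Vr} {S S' T T' : Typ},
    InvTyp Γ (.val v) (.all z S T) → TightSub Γ S' S →
    Subtyp ((z, S') :: Γ) T T' →
    InvTyp Γ (.val v) (.all z S' T')
| andV : ∀ {Γ : Ctx} {v : Vl} {T U : Typ},
    InvTyp Γ (.val v) T → InvTyp Γ (.val v) U → InvTyp Γ (.val v) (.and T U)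
| selV : ∀ {Γ : Ctx} {v : Vl} {y : Vr} {A : TypLabel} {S : Typ},
    InvTyp Γ (.val v) S → PrecTyp Γ (.var y) (.dec A S S) →
    InvTyp Γ (.val v) (.sel y A)
| topV : ∀ {Γ : Ctx} {v : Vl} {T : Typ},
    InvTyp Γ (.val v) T → InvTyp Γ (.val v) .top

/- A definition collection contains the field definition {a = t} -/
inductive DefHasFld : Dfs → TrmLabel → Trm → Prop
| fld : ∀ (a : TrmLabel) (t : Trm), DefHasFld (.fld a t) a t
| andL : ∀ {d₁ : Dfs} {a : TrmLabel} {t : Trm} (d₂ : Dfs),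
    DefHasFld d₁ a t → DefHasFld (.and d₁ d₂) a t
| andR : ∀ {d₂ : Dfs} {a : TrmLabel} {t : Trm} (d₁ : Dfs),
    DefHasFld d₂ a t → DefHasFld (.and d₁ d₂) a t

/- A type (an intersection) contains the field declaration {a : T} -/
inductive TypHasFld : Typ → TrmLabel → Typ → Prop
| fld : ∀ (a : TrmLabel) (T : Typ), TypHasFld (.fld a T) a T
| andL : ∀ {S : Typ} {a : TrmLabel} {T : Typ} (S' : Typ),
    TypHasFld S a T → TypHasFld (.and S S') a T
| andR : ∀ {S' : Typ} {a : TrmLabel} {T : Typ} (S : Typ),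
    TypHasFld S' a T → TypHasFld (.and S S') a T

/- Evaluation contexts  e ::= [] | let x = [] in t | let x = v in e -/
inductive ECtx : Type
| hole : ECtx
| letHole : Vr → Trm → ECtx
| letVal : Vr → Vl → ECtx → ECtx

def ECtx.plug : ECtx → Trm → Trm
| .hole, t => t
| .letHole x u, t => .lett x t u
| .letVal x v e, t => .lett x (.val v) (e.plug t)

/- Small-step operational semantics -/
inductive Red : Trm → Trm → Prop
| apply : ∀ (x y z : Vr) (T : Typ) (t : Trm) (e : ECtx),
    Red (.lett x (.val (.lam z T t)) (ECtx.plug e (.app x y)))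
        (.lett x (.val (.lam z T t)) (ECtx.plug e (t.subst z y)))
| project : ∀ (x : Vr) (T : Typ) (d : Dfs) (a : TrmLabel) (t : Trm) (e : ECtx),
    DefHasFld d a t →
    Red (.lett x (.val (.obj x T d)) (ECtx.plug e (.sel x a)))
        (.lett x (.val (.obj x T d)) (ECtx.plug e t))
| letVar : ∀ (x y : Vr) (t : Trm),
    Red (.lett x (.var y) t) (t.subst x y)
| letLet : ∀ (x y : Vr) (s t u : Trm),
    Red (.lett x (.lett y s t) u) (.lett y s (.lett x t u))
| ctx : ∀ {t t' : Trm} (e : ECtx),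
    Red t t' → Red (ECtx.plug e t) (ECtx.plug e t')

/- Normal forms: variables and values -/
def NormalForm : Trm → Prop
| .var _ => True
| .val _ => True
| _ => False

/- Replacing the binding of x in a context -/
def updateCtx : Ctx → Vr → Typ → Ctx
| [], _, _ => []
| (y, S) :: Γ, x, T => if y = x then (x, T) :: Γ else (y, S) :: updateCtx Γ x T

theorem Typ.subst_self (x : Vr) (T : Typ) : T.subst x x = T := by
  induction T <;> simp_all [Typ.subst]

theorem RecordTyp.subst {T : Typ} {L : Finset TypLabel} (x y : Vr) (h : RecordTyp T L) :
    RecordTyp (T.subst x y) L := by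
  induction h with
  | fld a T => exact .fld _ _
  | dec A T => exact .dec _ _
  | and _ _ hd ih1 ih2 => exact .and ih1 ih2 hd

inductive Conj : Typ → Typ → Prop
| refl : ∀ (T : Typ), Conj T T
| left : ∀ {T R S : Typ}, Conj T R → Conj T (.and R S)
| right : ∀ {T R S : Typ}, Conj T S → Conj T (.and R S)

theorem Conj.trans {T R Q : Typ} (h1 : Conj T R) (h2 : Conj R Q) : Conj T Q := by
  induction h2 with
  | refl => exact h1
  | left _ ih => exact .left ih
  | right _ ih => exact .right ih

theorem Conj.record {T R : Typ} (h : Conj T R) :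
    ∀ {L : Finset TypLabel}, RecordTyp R L → ∃ L', L' ⊆ L ∧ RecordTyp T L' := by
  induction h with
  | refl => intro L hr; exact ⟨L, subset_rfl, hr⟩
  | left _ ih =>
    intro L hr
    cases hr with
    | and a b c =>
      obtain ⟨L', h1, h2⟩ := ih a
      exact ⟨L', h1.trans Finset.subset_union_left, h2⟩
  | right _ ih =>
    intro L hr
    cases hr with
    | and a b c =>
      obtain ⟨L', h1, h2⟩ := ih b
      exact ⟨L', h1.trans Finset.subset_union_right, h2⟩

theorem Conj.dec_mem {A : TypLabel} {S U R : Typ} {L : Finset TypLabel}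
    (h : Conj (.dec A S U) R) (hr : RecordTyp R L) : A ∈ L ∧ S = U := by
  obtain ⟨L', h1, h2⟩ := h.record hr
  cases h2
  exact ⟨h1 (by simp), rfl⟩

theorem Conj.unique {R : Typ} {L : Finset TypLabel} (hr : RecordTyp R L) :
    ∀ {A : TypLabel} {S S' : Typ}, Conj (.dec A S S) R → Conj (.dec A S' S') R → S = S' := by
  induction hr with
  | fld a T => intro A S S' h; cases h
  | dec B T => intro A S S' h h'; cases h; cases h'; rfl
  | and a b hd iha ihb =>
    intro A S S' h h'
    cases h with
    | left h =>
      cases h' with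
      | left h' => exact iha h h'
      | right h' =>
        exact absurd (h'.dec_mem b).1 (Finset.disjoint_left.1 hd (h.dec_mem a).1)
    | right h =>
      cases h' with
      | left h' =>
        exact absurd (h.dec_mem b).1 (Finset.disjoint_left.1 hd (h'.dec_mem a).1)
      | right h' => exact ihb h h'

theorem prec_char {Γ : Ctx} (hΓ : InertCtx Γ) {t : Trm} {T : Typ} (h : PrecTyp Γ t T) :
    ∀ x, t = .var x → (lookupCtx Γ x = some T ∧ Inert T) ∨
      ∃ z R L, lookupCtx Γ x = some (.mu z R) ∧ RecordTyp (R.subst z x) L ∧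
        Conj T (R.subst z x) := by
  induction h with
  | var h => intro x hx; cases hx; exact .inl ⟨h, hΓ _ _ h⟩
  | recE _ ih =>
    intro x hx
    cases hx
    rcases ih _ rfl with ⟨h1, h2⟩ | ⟨z, R, L, _, h2, h3⟩
    · cases h2 with
      | mu h2 => exact .inr ⟨_, _, _, h1, h2.subst _ _, .refl _⟩
    · obtain ⟨_, _, h⟩ := h3.record h2
      cases h
  | and1 _ ih =>
    intro x hx
    cases hx
    rcases ih _ rfl with ⟨h1, h2⟩ | ⟨z, R, L, h1, h2, h3⟩
    · cases h2
    · exact .inr ⟨z, R, L, h1, h2, Conj.trans (.left (.refl _)) h3⟩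
  | and2 _ ih =>
    intro x hx
    cases hx
    rcases ih _ rfl with ⟨h1, h2⟩ | ⟨z, R, L, h1, h2, h3⟩
    · cases h2
    · exact .inr ⟨z, R, L, h1, h2, Conj.trans (.right (.refl _)) h3⟩
  | allI => intro x hx; cases hx
  | objI => intro x hx; cases hx

theorem prec_inert_or_record {Γ : Ctx} (hΓ : InertCtx Γ) {x : Vr} {T : Typ}
    (h : PrecTyp Γ (.var x) T) : Inert T ∨ ∃ L, RecordTyp T L := by
  rcases prec_char hΓ h x rfl with ⟨_, h⟩ | ⟨z, R, L, h1, h2, h3⟩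
  · exact .inl h
  · obtain ⟨L', _, h⟩ := h3.record h2
    exact .inr ⟨L', h⟩

theorem prec_unique {Γ : Ctx} (hΓ : InertCtx Γ) {x : Vr} {A : TypLabel} {S S' : Typ}
    (h : PrecTyp Γ (.var x) (.dec A S S)) (h' : PrecTyp Γ (.var x) (.dec A S' S')) :
    S = S' := by
  rcases prec_char hΓ h x rfl with ⟨_, h⟩ | ⟨z, R, L, h1, h2, h3⟩
  · cases h
  rcases prec_char hΓ h' x rfl with ⟨_, h⟩ | ⟨z', R', L', h1', h2', h3'⟩
  · cases h
  rw [h1] at h1'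
  cases h1'
  exact Conj.unique h2 h3 h3'

theorem inv_sub {Γ : Ctx} (hΓ : InertCtx Γ) {x : Vr} {T U : Typ} (hs : TightSub Γ T U)
    (h : InvTyp Γ (.var x) T) : InvTyp Γ (.var x) U := by
  match hs with
  | .top => exact .top h
  | .bot =>
    cases h with
    | var h => rcases prec_inert_or_record hΓ h with h | ⟨_, h⟩ <;> cases h
  | .refl => exact h
  | .trans h1 h2 => exact inv_sub hΓ h2 (inv_sub hΓ h1 h)
  | .and1 =>
    cases h with
    | var h => exact .var (.and1 h)
    | andI a b => exact a
  | .and2 =>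
    cases h with
    | var h => exact .var (.and2 h)
    | andI a b => exact b
  | .andI h1 h2 => exact .andI (inv_sub hΓ h1 h) (inv_sub hΓ h2 h)
  | .fld h1 => exact .fld h h1
  | .typ h1 h2 => exact .typ h h1 h2
  | .selLo h1 => exact .sel h h1
  | .selHi h1 =>
    cases h with
    | var h => rcases prec_inert_or_record hΓ h with h | ⟨_, h⟩ <;> cases h
    | sel h h2 =>
      cases prec_unique hΓ h1 h2
      exact h
  | .all h1 h2 => exact .allI h h1 h2
termination_by structural hs

theorem tight_inv {Γ : Ctx} (hΓ : InertCtx Γ) {t : Trm} {T : Typ} (h : TightTyp Γ t T) :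
    ∀ x, t = .var x → InvTyp Γ (.var x) T := by
  intro x hx
  match h with
  | .var h => cases hx; exact .var (.var h)
  | .allI _ _ => cases hx
  | .allE _ _ => cases hx
  | .objI _ => cases hx
  | .fldE _ => cases hx
  | .lett _ _ _ => cases hx
  | .recI h =>
    have hi := tight_inv hΓ h x hx
    cases hx
    exact .recI hi
  | .recE h =>
    have hi := tight_inv hΓ h x hx
    clear h
    cases hx
    cases hi with
    | var h => exact .var (.recE h)
    | recI h => rw [Typ.subst_self]; exact h
  | .andI h1 h2 => exact .andI (tight_inv hΓ h1 x hx) (tight_inv hΓ h2 x hx)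
  | .sub h1 h2 => exact inv_sub hΓ h2 (tight_inv hΓ h1 _ hx)
termination_by structural h

theorem inv_dec {Γ : Ctx} (hΓ : InertCtx Γ) {t : Trm} {Q : Typ} (h : InvTyp Γ t Q) :
    ∀ x A S U, t = .var x → Q = .dec A S U →
      ∃ T, PrecTyp Γ (.var x) (.dec A T T) ∧ TightSub Γ S T ∧ TightSub Γ T U := by
  induction h with
  | var h =>
    rintro x A S U hx rfl
    cases hx
    rcases prec_inert_or_record hΓ h with h' | ⟨_, h'⟩
    · cases h'
    · cases h'
      exact ⟨_, h, .refl, .refl⟩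
  | typ _ h1 h2 ih =>
    rintro x A S U hx hQ
    cases hx
    cases hQ
    obtain ⟨T, a, b, c⟩ := ih _ _ _ _ rfl rfl
    exact ⟨T, a, .trans h1 b, .trans c h2⟩
  | _ => intro x A S U hx hQ; first | cases hx; done | cases hQ; done

theorem sel_replacement (Γ : Ctx) (x : Vr) (A : TypLabel) (S U : Typ)
    (hΓ : InertCtx Γ) (h : TightTyp Γ (.var x) (.dec A S U)) :
    TightSub Γ S (.sel x A) ∧ TightSub Γ (.sel x A) U := by
  obtain ⟨T, a, b, c⟩ := inv_dec hΓ (tight_inv hΓ h x rfl) x A S U rfl rfl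
  exact ⟨.trans b (.selLo a), .trans (.selHi a) c⟩
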